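/- (Positivity of the exponent α5) Let Y be a finite alphabet and let π and μ be distinct pmfs on Y with full support. Then the infimum, over triples of pmfs (q1, q2, q3) on Y satisfying D(q1‖q2) > D(q1‖q3), of D(q1‖π) + D(q2‖π) + D(q3‖μ), is strictly positive. -/

import Mathlib

open scoped BigOperators

/-- A probability mass function on a finite alphabet `Y`. -/
def IsPmf {Y : Type*} [Fintype Y] (p : Y → ℝ) : Prop :=
  (∀ y, 0 ≤ p y) ∧ ∑ y, p y = 1

/-- KL divergence `D(p‖q)`, valued in the extended reals: it is `+∞` when the
support of `p` is not contained in that of `q`. -/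
noncomputable def KL {Y : Type*} [Fintype Y] (p q : Y → ℝ) : EReal :=
  if ∀ y, q y = 0 → p y = 0 then ((∑ y, p y * Real.log (p y / q y) : ℝ) : EReal) else ⊤

/-- Bhattacharyya distance `B(p,q) = −log( Σ_y √(p y) √(q y) )`. -/
noncomputable def Bhat {Y : Type*} [Fintype Y] (p q : Y → ℝ) : ℝ :=
  - Real.log (∑ y, Real.sqrt (p y) * Real.sqrt (q y))

/-- Each term of the KL divergence dominates the corresponding squared Hellinger term, up to a
difference that sums to zero over pmfs. -/
lemma sq_sqrt_sub_sqrt_add_le_mul_log {a b : ℝ} (ha : 0 ≤ a) (hb : 0 ≤ b) (hab : b = 0 → a = 0) :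
    (√a - √b) ^ 2 + (a - b) ≤ a * Real.log (a / b) := by
  rcases ha.eq_or_lt with rfl | ha'
  · simp [Real.sq_sqrt hb]
  have hb' : 0 < b := hb.lt_of_ne fun h => ha'.ne' (hab h.symm)
  have hsa : 0 < √a := Real.sqrt_pos.2 ha'
  have hsb : 0 < √b := Real.sqrt_pos.2 hb'
  have hlog : Real.log (a / b) = 2 * Real.log (√a / √b) := by
    rw [← Real.sqrt_div ha, Real.log_sqrt (by positivity)]
    ring
  have hle := Real.one_sub_inv_le_log_of_pos (div_pos hsa hsb)
  have hmul : a * (1 - (√a / √b)⁻¹) = a - √a * √b := by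
    nth_rewrite 1 [← Real.sq_sqrt ha]
    nth_rewrite 3 [← Real.sq_sqrt ha]
    field_simp
  have := mul_le_mul_of_nonneg_left hle ha
  rw [hlog]
  nlinarith [Real.sq_sqrt ha, Real.sq_sqrt hb]

/-- A Pinsker-type inequality: the KL divergence controls pointwise squared differences. -/
lemma IsPmf.sq_sub_div_four_le_KL {Y : Type*} [Fintype Y] {p q : Y → ℝ} (hp : IsPmf p)
    (hq : IsPmf q) (y : Y) : (((p y - q y) ^ 2 / 4 : ℝ) : EReal) ≤ KL p q := by
  unfold KL
  split_ifs with h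
  · rw [EReal.coe_le_coe_iff]
    have hp1 : p y ≤ 1 := hp.2 ▸ Finset.single_le_sum (fun i _ => hp.1 i) (Finset.mem_univ y)
    have hq1 : q y ≤ 1 := hq.2 ▸ Finset.single_le_sum (fun i _ => hq.1 i) (Finset.mem_univ y)
    have hsum : (p y - q y) ^ 2 = (√(p y) - √(q y)) ^ 2 * (√(p y) + √(q y)) ^ 2 := by
      rw [← mul_pow]
      congr 1
      nlinarith [Real.sq_sqrt (hp.1 y), Real.sq_sqrt (hq.1 y)]
    have hfour : (√(p y) + √(q y)) ^ 2 ≤ 4 := by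
      nlinarith [Real.sq_sqrt (hp.1 y), Real.sq_sqrt (hq.1 y), sq_nonneg (√(p y) - √(q y))]
    calc (p y - q y) ^ 2 / 4 ≤ (√(p y) - √(q y)) ^ 2 := by
          rw [hsum]
          nlinarith [sq_nonneg (√(p y) - √(q y))]
      _ ≤ ∑ z, (√(p z) - √(q z)) ^ 2 :=
          Finset.single_le_sum (f := fun z => (√(p z) - √(q z)) ^ 2)
            (fun _ _ => sq_nonneg _) (Finset.mem_univ y)
      _ = ∑ z, ((√(p z) - √(q z)) ^ 2 + (p z - q z)) := by
          rw [Finset.sum_add_distrib, Finset.sum_sub_distrib, hp.2, hq.2]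
          ring
      _ ≤ _ := Finset.sum_le_sum fun z _ =>
          sq_sqrt_sub_sqrt_add_le_mul_log (hp.1 z) (hq.1 z) (h z)
  · exact le_top

lemma IsPmf.KL_nonneg {Y : Type*} [Fintype Y] [Nonempty Y] {p q : Y → ℝ} (hp : IsPmf p)
    (hq : IsPmf q) : 0 ≤ KL p q :=
  le_trans (by exact_mod_cast by positivity) (hp.sq_sub_div_four_le_KL hq (Classical.arbitrary Y))

lemma IsPmf.dist_lt_of_KL_lt {Y : Type*} [Fintype Y] {p q : Y → ℝ} (hp : IsPmf p) (hq : IsPmf q)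
    {δ : ℝ} (hδ : 0 < δ) (h : KL p q < ((δ ^ 2 / 4 : ℝ) : EReal)) : dist p q < δ := by
  rw [dist_pi_lt_iff hδ]
  intro y
  have hy := EReal.coe_lt_coe_iff.1 ((hp.sq_sub_div_four_le_KL hq y).trans_lt h)
  rw [Real.dist_eq]
  exact abs_lt_of_sq_lt_sq (by linarith) hδ.le

lemma KL_of_pos {Y : Type*} [Fintype Y] (p : Y → ℝ) {q : Y → ℝ} (hq : ∀ y, 0 < q y) :
    KL p q = ((∑ y, p y * Real.log (p y / q y) : ℝ) : EReal) :=
  if_pos fun y h => absurd h (hq y).ne'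

lemma KL_lt_KL_iff {Y : Type*} [Fintype Y] {p q r : Y → ℝ} (hq : ∀ y, 0 < q y)
    (hr : ∀ y, 0 < r y) :
    KL p q < KL p r ↔ ∑ y, p y * (Real.log (r y) - Real.log (q y)) < 0 := by
  rw [KL_of_pos p hq, KL_of_pos p hr, EReal.coe_lt_coe_iff, ← sub_neg, ← Finset.sum_sub_distrib]
  refine iff_of_eq (congrArg (· < 0) (Finset.sum_congr rfl fun y _ => ?_))
  rcases eq_or_ne (p y) 0 with h | h
  · simp [h]
  · rw [Real.log_div h (hq y).ne', Real.log_div h (hr y).ne']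
    ring

lemma IsPmf.sum_mul_log_sub_log_pos {Y : Type*} [Fintype Y] {p q : Y → ℝ} (hp : IsPmf p)
    (hq : IsPmf q) (hpf : ∀ y, 0 < p y) (hqf : ∀ y, 0 < q y) (hne : p ≠ q) :
    0 < ∑ y, p y * (Real.log (p y) - Real.log (q y)) := by
  obtain ⟨y, hy⟩ := Function.ne_iff.1 hne
  have h := hp.sq_sub_div_four_le_KL hq y
  rw [KL_of_pos p hqf, EReal.coe_le_coe_iff] at h
  simp_rw [Real.log_div (hpf _).ne' (hqf _).ne'] at h
  have : 0 < (p y - q y) ^ 2 := sq_pos_of_ne_zero (sub_ne_zero.2 hy)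
  linarith

open Topology in
/-- Near `(π, π, μ)` the middle pmf is the better match for the first one. -/
lemma eventually_not_KL_lt_KL {Y : Type*} [Fintype Y] {π μ : Y → ℝ} (hπ : IsPmf π) (hμ : IsPmf μ)
    (hπf : ∀ y, 0 < π y) (hμf : ∀ y, 0 < μ y) (hne : π ≠ μ) :
    ∀ᶠ x : (Y → ℝ) × (Y → ℝ) × (Y → ℝ) in 𝓝 (π, π, μ), ¬ KL x.1 x.2.2 < KL x.1 x.2.1 := by
  have hcont : ContinuousAt (fun x : (Y → ℝ) × (Y → ℝ) × (Y → ℝ) =>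
      ∑ y, x.1 y * (Real.log (x.2.1 y) - Real.log (x.2.2 y))) (π, π, μ) := by
    refine tendsto_finsetSum _ fun y _ => ?_
    refine ContinuousAt.mul (by fun_prop) (ContinuousAt.sub ?_ ?_)
    · exact ContinuousAt.log (by fun_prop) (hπf y).ne'
    · exact ContinuousAt.log (by fun_prop) (hμf y).ne'
  have hpos2 : ∀ᶠ x : (Y → ℝ) × (Y → ℝ) × (Y → ℝ) in 𝓝 (π, π, μ), ∀ y, 0 < x.2.1 y :=
    Filter.eventually_all.2 fun y =>
      ContinuousAt.eventually_lt (f := fun _ => (0 : ℝ)) (by fun_prop) (by fun_prop) (hπf y)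
  have hpos3 : ∀ᶠ x : (Y → ℝ) × (Y → ℝ) × (Y → ℝ) in 𝓝 (π, π, μ), ∀ y, 0 < x.2.2 y :=
    Filter.eventually_all.2 fun y =>
      ContinuousAt.eventually_lt (f := fun _ => (0 : ℝ)) (by fun_prop) (by fun_prop) (hμf y)
  filter_upwards [hcont.eventually_const_lt (hπ.sum_mul_log_sub_log_pos hμ hπf hμf hne), hpos2,
    hpos3] with x hx h2 h3
  rw [KL_lt_KL_iff h3 h2]
  exact hx.not_gt

/-- positivity of the exponent α5. For distinct full-support
pmfs `π` and `μ`, the infimum over pmf triples `(q1,q2,q3)` satisfying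
`D(q1‖q2) > D(q1‖q3)` of `D(q1‖π) + D(q2‖π) + D(q3‖μ)` is strictly positive. -/
theorem alpha5_pos {Y : Type*} [Fintype Y] [Nonempty Y]
    (π μ : Y → ℝ) (hπ : IsPmf π) (hμ : IsPmf μ)
    (hπf : ∀ y, 0 < π y) (hμf : ∀ y, 0 < μ y) (hne : π ≠ μ) :
    0 < sInf {r : EReal | ∃ q1 q2 q3 : Y → ℝ,
      IsPmf q1 ∧ IsPmf q2 ∧ IsPmf q3 ∧
      KL q1 q3 < KL q1 q2 ∧
      r = KL q1 π + KL q2 π + KL q3 μ} := by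
  obtain ⟨δ, hδ, hball⟩ :=
    Metric.eventually_nhds_iff.1 (eventually_not_KL_lt_KL hπ hμ hπf hμf hne)
  have hε : (0 : EReal) < ((δ ^ 2 / 4 : ℝ) : EReal) := by exact_mod_cast by positivity
  refine hε.trans_le (le_sInf ?_)
  rintro r ⟨q1, q2, q3, h1, h2, h3, hlt, rfl⟩
  by_contra! hr
  have k1 := h1.KL_nonneg hπ
  have k2 := h2.KL_nonneg hπ
  have k3 := h3.KL_nonneg hμ
  have hr12 := (le_add_of_nonneg_right k3).trans_lt hr
  refine hball (y := (q1, q2, q3)) ?_ hlt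
  simp only [Prod.dist_eq, max_lt_iff]
  exact ⟨h1.dist_lt_of_KL_lt hπ hδ ((le_add_of_nonneg_right k2).trans_lt hr12),
    h2.dist_lt_of_KL_lt hπ hδ ((le_add_of_nonneg_left k1).trans_lt hr12),
    h3.dist_lt_of_KL_lt hμ hδ ((le_add_of_nonneg_left (add_nonneg k1 k2)).trans_lt hr)⟩
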